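/- Let G be an infinite, locally finite, connected simple graph with countable edge set E, and let (U(e))_{e ∈ E} be i.i.d. uniform [0,1] random variables under the product measure P on [0,1]^E. Then for every event A in the tail σ-field of 2^E, P[F_f(U) ∈ A] ∈ {0,1}, and likewise P[F_w(U) ∈ A] ∈ {0,1}. That is, both the free and the wired minimal spanning forest measures have trivial tail σ-field. -/

import Mathlib

open SimpleGraph

/-- The set of edges of `G` whose endpoints cannot be joined by a path all of whose
edges have strictly smaller label: the (free) minimal spanning forest / tree of `G`. -/
def mstEdges {V α : Type*} [LinearOrder α] (G : SimpleGraph V) (U : Sym2 V → α) :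
    Set (Sym2 V) :=
  {e | e ∈ G.edgeSet ∧ ∀ a b : V, e = s(a, b) →
    ∀ p : G.Walk a b, p.IsPath → ∃ f ∈ p.edges, U e ≤ U f}

/-- A one-sided infinite simple path in `G`. -/
def IsRay {V : Type*} (G : SimpleGraph V) (r : ℕ → V) : Prop :=
  Function.Injective r ∧ ∀ n : ℕ, G.Adj (r n) (r (n + 1))

/-- The edges of a one-sided infinite path. -/
def rayEdges {V : Type*} (r : ℕ → V) : Set (Sym2 V) :=
  Set.range fun n : ℕ => s(r n, r (n + 1))

/-- The wired minimal spanning forest of `G`: edges such that every extended path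
(finite simple path, or pair of disjoint rays from the two endpoints) joining the
endpoints contains an edge of label at least as large. -/
def wmsfEdges {V : Type*} (G : SimpleGraph V) (U : Sym2 V → ℝ) : Set (Sym2 V) :=
  {e | e ∈ G.edgeSet ∧ ∀ a b : V, e = s(a, b) →
    (∀ p : G.Walk a b, p.IsPath → ∃ f ∈ p.edges, U e ≤ U f) ∧
    (∀ r₁ r₂ : ℕ → V, IsRay G r₁ → IsRay G r₂ → r₁ 0 = a → r₂ 0 = b →
      (∀ m n : ℕ, r₁ m ≠ r₂ n) →
      ∃ f ∈ rayEdges r₁ ∪ rayEdges r₂, U e ≤ U f)}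

/-- The edges of `G` joining `W` to its complement. -/
def cutEdges {V : Type*} (G : SimpleGraph V) (W : Set V) : Set (Sym2 V) :=
  {e | e ∈ G.edgeSet ∧ ∃ a b : V, e = s(a, b) ∧ a ∈ W ∧ b ∉ W}

/-- A bi-infinite simple path in `G`. -/
def IsBiRay {V : Type*} (G : SimpleGraph V) (r : ℤ → V) : Prop :=
  Function.Injective r ∧ ∀ n : ℤ, G.Adj (r n) (r (n + 1))

/-- The edges of a bi-infinite simple path. -/
def biRayEdges {V : Type*} (r : ℤ → V) : Set (Sym2 V) :=
  Set.range fun n : ℤ => s(r n, r (n + 1))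

open MeasureTheory

/-- The σ-field on `2^E` generated by the coordinates `{F | e ∈ F}` for `e ∈ s`. -/
def edgeSigma {V : Type*} (s : Set (Sym2 V)) : MeasurableSpace (Set (Sym2 V)) :=
  MeasurableSpace.generateFrom {B : Set (Set (Sym2 V)) | ∃ e ∈ s, B = {F : Set (Sym2 V) | e ∈ F}}

/-- The tail σ-field on `2^E`: the intersection over all finite `K ⊆ E` of the
σ-fields generated by the coordinates outside `K`. -/
def tailSigma (V : Type*) : MeasurableSpace (Set (Sym2 V)) :=
  ⨅ K : Finset (Sym2 V), edgeSigma ((↑K : Set (Sym2 V))ᶜ)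

/-- The subgraph of `G` formed by the edges of label less than `t`. -/
def belowGraph {V α : Type*} [LinearOrder α] (G : SimpleGraph V) (U : Sym2 V → α) (t : α) :
    SimpleGraph V where
  Adj x y := G.Adj x y ∧ U s(x, y) < t
  symm := ⟨fun x y h => ⟨h.1.symm, Sym2.eq_swap (a := x) (b := y) ▸ h.2⟩⟩
  loopless := ⟨fun _ h => h.1.ne rfl⟩

/-- A notion of connectivity in subgraphs: an equivalence relation that is monotone in the graph,
contains adjacency, and grows in the expected way when one edge is added. -/
structure IsConnectivity {V : Type*} (R : SimpleGraph V → V → V → Prop) : Prop where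
  equiv : ∀ H, Equivalence (R H)
  mono : ∀ {H H' : SimpleGraph V} {x y : V}, H ≤ H' → R H x y → R H' x y
  of_adj : ∀ {H : SimpleGraph V} {x y : V}, H.Adj x y → R H x y
  of_sup_edge : ∀ {H : SimpleGraph V} {a b x y : V}, R (H ⊔ edge a b) x y →
    R H x y ∨ (R H x a ∧ R H b y) ∨ (R H x b ∧ R H a y)

/-- The edges whose endpoints are not connected, in the sense of `R`, by edges of smaller label. -/
def forestOf {V α : Type*} [LinearOrder α] (R : SimpleGraph V → V → V → Prop)
    (G : SimpleGraph V) (U : Sym2 V → α) : Set (Sym2 V) :=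
  {e | e ∈ G.edgeSet ∧ ∀ a b : V, e = s(a, b) → ¬ R (belowGraph G U (U e)) a b}

section Connectivity

variable {V α : Type*} [LinearOrder α] {G : SimpleGraph V} {R : SimpleGraph V → V → V → Prop}

lemma belowGraph_mono (G : SimpleGraph V) {U U' : Sym2 V → α} (h : U ≤ U') {s t : α}
    (hst : s ≤ t) : belowGraph G U' s ≤ belowGraph G U t :=
  fun _ _ hxy => ⟨hxy.1, ((h _).trans_lt hxy.2).trans_le hst⟩

lemma belowGraph_le_update_sup_edge (G : SimpleGraph V) [DecidableEq (Sym2 V)] (U : Sym2 V → α)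
    (a b : V) (u t : α) :
    belowGraph G U t ≤ belowGraph G (Function.update U s(a, b) u) t ⊔ edge a b := by
  intro x y h
  rw [SimpleGraph.sup_adj]
  by_cases hxy : s(x, y) = s(a, b)
  · exact Or.inr ((adj_edge a b).2 ⟨hxy.symm, h.1.ne⟩)
  · refine Or.inl ⟨h.1, ?_⟩
    rw [Function.update_of_ne hxy]
    exact h.2

/-- Raising the label of `s(a, b)` can only remove that edge from the forest. -/
lemma forestOf_subset_update (hR : IsConnectivity R) [DecidableEq (Sym2 V)] (U : Sym2 V → α)
    (e : Sym2 V) {u : α} (hu : U e ≤ u) :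
    forestOf R G U \ {e} ⊆ forestOf R G (Function.update U e u) := by
  rintro f ⟨⟨hfG, hf⟩, hfe⟩
  refine ⟨hfG, fun x y hxy hr => hf x y hxy (hR.mono ?_ hr)⟩
  rw [Function.update_of_ne hfe]
  exact belowGraph_mono G (le_update_self_iff.2 hu) le_rfl

/-- An edge that enters the forest when the label of `s(a, b)` is raised is joined to `s(a, b)`
by edges of smaller label. -/
lemma connected_of_mem_update_diff (hR : IsConnectivity R) [DecidableEq (Sym2 V)]
    {U : Sym2 V → α} {a b x y : V} {u : α}
    (hf : s(x, y) ∈ forestOf R G (Function.update U s(a, b) u)) (hf' : s(x, y) ∉ forestOf R G U)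
    (hne : s(x, y) ≠ s(a, b)) :
    (R (belowGraph G (Function.update U s(a, b) u) (U s(x, y))) x a ∧
      R (belowGraph G (Function.update U s(a, b) u) (U s(x, y))) b y) ∨
    (R (belowGraph G (Function.update U s(a, b) u) (U s(x, y))) x b ∧
      R (belowGraph G (Function.update U s(a, b) u) (U s(x, y))) a y) := by
  have hnot := hf.2 x y rfl
  rw [Function.update_of_ne hne] at hnot
  have hcon : R (belowGraph G U (U s(x, y))) x y := by
    by_contra hcon
    refine hf' ⟨hf.1, fun x' y' h hr => hcon ?_⟩
    rcases Sym2.eq_iff.1 h with ⟨rfl, rfl⟩ | ⟨rfl, rfl⟩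
    · exact hr
    · exact (hR.equiv _).symm hr
  exact (hR.of_sup_edge (hR.mono (belowGraph_le_update_sup_edge G U a b u _) hcon)).resolve_left
    hnot

lemma subsingleton_update_diff (hR : IsConnectivity R) [DecidableEq (Sym2 V)] {U : Sym2 V → α}
    (hU : Function.Injective U) (e : Sym2 V) (u : α) :
    ((forestOf R G (Function.update U e u) \ forestOf R G U) \ {e}).Subsingleton := by
  have key : ∀ f g : Sym2 V,
      f ∈ (forestOf R G (Function.update U e u) \ forestOf R G U) \ {e} →
      g ∈ (forestOf R G (Function.update U e u) \ forestOf R G U) \ {e} → ¬ U f < U g := by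
    induction e with | _ a b
    intro f g
    induction f with | _ x y
    induction g with | _ z w
    rintro ⟨⟨hf, hf'⟩, hfe⟩ ⟨⟨hg, hg'⟩, hge⟩ hlt
    set U' := Function.update U s(a, b) u with hU'
    have hle : belowGraph G U' (U s(x, y)) ≤ belowGraph G U' (U s(z, w)) :=
      belowGraph_mono G le_rfl hlt.le
    have hE := hR.equiv (belowGraph G U' (U s(z, w)))
    have hxy : R (belowGraph G U' (U s(z, w))) x y :=
      hR.of_adj ⟨hf.1, by rw [hU', Function.update_of_ne hfe]; exact hlt⟩
    have hab : R (belowGraph G U' (U s(z, w))) a b := by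
      rcases connected_of_mem_update_diff hR hf hf' hfe with ⟨h₁, h₂⟩ | ⟨h₁, h₂⟩
      · exact hE.trans (hE.symm (hR.mono hle h₁)) (hE.trans hxy (hE.symm (hR.mono hle h₂)))
      · exact hE.trans (hR.mono hle h₂) (hE.trans (hE.symm hxy) (hR.mono hle h₁))
    have hnot := hg.2 z w rfl
    rw [hU', Function.update_of_ne hge] at hnot
    rcases connected_of_mem_update_diff hR hg hg' hge with ⟨h₁, h₂⟩ | ⟨h₁, h₂⟩
    · exact hnot (hE.trans h₁ (hE.trans hab h₂))
    · exact hnot (hE.trans h₁ (hE.trans (hE.symm hab) h₂))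
  intro f hf g hg
  exact hU (le_antisymm (not_lt.1 (key g f hg hf)) (not_lt.1 (key f g hf hg)))

lemma finite_symmDiff_update (hR : IsConnectivity R) [DecidableEq (Sym2 V)] {U : Sym2 V → α}
    {e : Sym2 V} {u : α} (hU : Function.Injective U)
    (hU' : Function.Injective (Function.update U e u)) :
    (symmDiff (forestOf R G U) (forestOf R G (Function.update U e u))).Finite := by
  have key : ∀ (W : Sym2 V → α) (w : α), Function.Injective W → W e ≤ w →
      (symmDiff (forestOf R G W) (forestOf R G (Function.update W e w))).Finite := by
    intro W w hW hw
    refine ((Set.finite_singleton e).union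
      (subsingleton_update_diff (G := G) hR hW e w).finite).subset ?_
    rintro f (⟨h₁, h₂⟩ | ⟨h₁, h₂⟩) <;> by_cases hfe : f = e
    · exact Or.inl hfe
    · exact absurd (forestOf_subset_update hR W e hw ⟨h₁, hfe⟩) h₂
    · exact Or.inl hfe
    · exact Or.inr ⟨⟨h₁, h₂⟩, hfe⟩
  rcases le_total (U e) u with h | h
  · exact key U u hU h
  · have := key (Function.update U e u) (U e) hU' (by simpa using h)
    rwa [Function.update_idem, Function.update_eq_self, symmDiff_comm] at this

/-- Replacing finitely many labels changes the forest in finitely many edges. -/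
lemma finite_symmDiff_piecewise (hR : IsConnectivity R) [DecidableEq (Sym2 V)]
    {U c : Sym2 V → α} (hU : Function.Injective U) (hc : Function.Injective c)
    (hUc : ∀ e f, U e ≠ c f) (K : Finset (Sym2 V)) :
    (symmDiff (forestOf R G U) (forestOf R G (K.piecewise c U))).Finite := by
  have hinj : ∀ K : Finset (Sym2 V), Function.Injective (K.piecewise c U) := by
    intro K e f hef
    by_cases he : e ∈ K <;> by_cases hf : f ∈ K <;> simp only [Finset.piecewise, he, hf,
      if_true, if_false] at hef
    · exact hc hef
    · exact absurd hef.symm (hUc _ _)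
    · exact absurd hef (hUc _ _)
    · exact hU hef
  induction K using Finset.induction_on with
  | empty => simp
  | insert e K _ ih =>
    have hK := hinj (insert e K)
    rw [Finset.piecewise_insert] at hK ⊢
    exact (ih.union (finite_symmDiff_update hR (hinj K) hK)).subset (symmDiff_triangle _ _ _)

end Connectivity

section Reachability

variable {V : Type*} {H : SimpleGraph V}

lemma reachable_of_sup_edge {a b x y : V} (h : (H ⊔ edge a b).Reachable x y) :
    H.Reachable x y ∨ (H.Reachable x a ∧ H.Reachable b y) ∨
      (H.Reachable x b ∧ H.Reachable a y) := by
  obtain ⟨p⟩ := h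
  induction p with
  | nil => exact Or.inl .rfl
  | @cons x z y hxz p ih =>
    rw [SimpleGraph.sup_adj] at hxz
    rcases hxz with hxz | hxz
    · have := hxz.reachable
      rcases ih with ih | ih | ih
      · exact Or.inl (this.trans ih)
      · exact Or.inr (Or.inl ⟨this.trans ih.1, ih.2⟩)
      · exact Or.inr (Or.inr ⟨this.trans ih.1, ih.2⟩)
    · rw [edge_adj] at hxz
      rcases hxz.1 with ⟨rfl, rfl⟩ | ⟨rfl, rfl⟩
      · rcases ih with ih | ih | ih
        · exact Or.inr (Or.inl ⟨.rfl, ih⟩)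
        · exact Or.inr (Or.inl ⟨.rfl, ih.2⟩)
        · exact Or.inl ih.2
      · rcases ih with ih | ih | ih
        · exact Or.inr (Or.inr ⟨.rfl, ih⟩)
        · exact Or.inl ih.2
        · exact Or.inr (Or.inr ⟨.rfl, ih.2⟩)

lemma isConnectivity_reachable : IsConnectivity (SimpleGraph.Reachable (V := V)) where
  equiv H := H.reachable_is_equivalence
  mono h hr := hr.mono h
  of_adj h := h.reachable
  of_sup_edge := reachable_of_sup_edge

/-- The component of `x` in `H` is infinite. -/
def InfiniteComponent (H : SimpleGraph V) (x : V) : Prop := {y | H.Reachable x y}.Infinite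

/-- Connectivity in the graph where all infinite components are joined at infinity. -/
def WiredReachable (H : SimpleGraph V) (x y : V) : Prop :=
  H.Reachable x y ∨ InfiniteComponent H x ∧ InfiniteComponent H y

lemma InfiniteComponent.of_reachable {x y : V} (hx : InfiniteComponent H x)
    (h : H.Reachable x y) : InfiniteComponent H y :=
  Set.Infinite.mono (fun _ hz => h.symm.trans hz) hx

lemma InfiniteComponent.of_sup_edge {a b x : V} (h : InfiniteComponent (H ⊔ edge a b) x) :
    InfiniteComponent H x ∨ (H.Reachable x a ∧ InfiniteComponent H b) ∨
      (H.Reachable x b ∧ InfiniteComponent H a) := by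
  by_contra! hcon
  obtain ⟨hx, ha, hb⟩ := hcon
  have hfin : ∀ {p : Prop} {z : V}, (p → ¬ InfiniteComponent H z) →
      {y | p ∧ H.Reachable z y}.Finite := by
    intro p z hz
    by_cases hp : p
    · simpa [hp, InfiniteComponent] using hz hp
    · simp [hp]
  refine h (((Set.not_infinite.1 hx).union ((hfin ha).union (hfin hb))).subset ?_)
  exact fun y hy => reachable_of_sup_edge hy

lemma isConnectivity_wiredReachable : IsConnectivity (WiredReachable (V := V)) where
  equiv H :=
    { refl _ := Or.inl .rfl
      symm h := h.imp (·.symm) And.symm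
      trans := by
        rintro x y z (h | h) (h' | h')
        · exact Or.inl (h.trans h')
        · exact Or.inr ⟨h'.1.of_reachable h.symm, h'.2⟩
        · exact Or.inr ⟨h.1, h.2.of_reachable h'⟩
        · exact Or.inr ⟨h.1, h'.2⟩ }
  mono hle h := h.imp (·.mono hle) fun h =>
    ⟨h.1.mono fun _ hz => Reachable.mono hle hz, h.2.mono fun _ hz => Reachable.mono hle hz⟩
  of_adj h := Or.inl h.reachable
  of_sup_edge := by
    intro H a b x y h
    rcases h with h | ⟨hx, hy⟩
    · exact (reachable_of_sup_edge h).imp Or.inl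
        (Or.imp (And.imp Or.inl Or.inl) (And.imp Or.inl Or.inl))
    · rcases hx.of_sup_edge with hx | ⟨hxa, hb⟩ | ⟨hxb, ha⟩ <;>
      rcases hy.of_sup_edge with hy | ⟨hya, hb'⟩ | ⟨hyb, ha'⟩
      · exact Or.inl (Or.inr ⟨hx, hy⟩)
      · exact Or.inr (Or.inr ⟨Or.inr ⟨hx, hb'⟩, Or.inl hya.symm⟩)
      · exact Or.inr (Or.inl ⟨Or.inr ⟨hx, ha'⟩, Or.inl hyb.symm⟩)
      · exact Or.inr (Or.inl ⟨Or.inl hxa, Or.inr ⟨hb, hy⟩⟩)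
      · exact Or.inl (Or.inl (hxa.trans hya.symm))
      · exact Or.inr (Or.inl ⟨Or.inl hxa, Or.inl hyb.symm⟩)
      · exact Or.inr (Or.inr ⟨Or.inl hxb, Or.inr ⟨ha, hy⟩⟩)
      · exact Or.inr (Or.inr ⟨Or.inl hxb, Or.inl hya.symm⟩)
      · exact Or.inl (Or.inl (hxb.trans hyb.symm))

lemma IsRay.reachable {r : ℕ → V} (hr : IsRay H r) (n : ℕ) : H.Reachable (r 0) (r n) := by
  induction n with
  | zero => exact .rfl
  | succ n ih => exact ih.trans (hr.2 n).reachable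

lemma IsRay.infiniteComponent {r : ℕ → V} (hr : IsRay H r) : InfiniteComponent H (r 0) :=
  (Set.infinite_range_of_injective hr.1).mono (by rintro _ ⟨n, rfl⟩; exact hr.reachable n)

/-- König's lemma: in a locally finite graph, every vertex of an infinite component is the origin
of a ray. -/
lemma InfiniteComponent.exists_isRay (hlf : ∀ v, (H.neighborSet v).Finite) {x : V}
    (hx : InfiniteComponent H x) : ∃ r, IsRay H r ∧ r 0 = x := by
  let D : V → Set V := fun v =>
    {w | H.Reachable v w ∧ H.dist x w = H.dist x v + H.dist v w}
  have hstep : ∀ v : {v // H.Reachable x v ∧ (D v).Infinite},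
      ∃ v' : {v // H.Reachable x v ∧ (D v).Infinite},
        H.Adj v v' ∧ H.dist x v' = H.dist x v + 1 := by
    rintro ⟨v, hxv, hv⟩
    by_contra! hcon
    have hcon' : ∀ v' ∈ H.neighborSet v,
        {w | w ∈ D v' ∧ H.dist x v' = H.dist x v + 1}.Finite := by
      intro v' hv'
      by_contra hinf
      obtain ⟨w, -, hw⟩ := (show Set.Infinite _ from hinf).nonempty
      exact hcon ⟨v', hxv.trans (Adj.reachable hv'),
        Set.Infinite.mono (fun _ h => h.1) hinf⟩ hv' hw
    refine hv (((Set.finite_singleton v).union ((hlf v).biUnion hcon')).subset ?_)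
    rintro w ⟨hvw, hd⟩
    obtain ⟨p, hp⟩ := hvw.exists_walk_length_eq_dist
    cases p with
    | nil => exact Or.inl rfl
    | @cons _ v' _ hadj q =>
      refine Or.inr (Set.mem_biUnion (x := v') hadj ?_)
      have h₁ := H.dist_le q
      rw [Walk.length_cons] at hp
      have h₂ := hxv.dist_triangle_left v'
      have h₃ := (hxv.trans hadj.reachable).dist_triangle_left w
      have h₄ : H.dist v v' = 1 := SimpleGraph.dist_eq_one_iff_adj.2 hadj
      exact ⟨⟨⟨q⟩, by omega⟩, by omega⟩
  choose next hadj hdist using hstep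
  have hx' : (D x).Infinite := by
    refine Set.Infinite.mono (fun w hw => ⟨hw, ?_⟩) hx
    simp
  let r : ℕ → {v // H.Reachable x v ∧ (D v).Infinite} :=
    fun n => next^[n] ⟨x, .rfl, hx'⟩
  have hr : ∀ n, r (n + 1) = next (r n) := fun n => Function.iterate_succ_apply' _ _ _
  have hrd : ∀ n, H.dist x (r n) = n := by
    intro n
    induction n with
    | zero => simp [r]
    | succ n ih => rw [hr, hdist, ih]
  refine ⟨fun n => r n, ⟨fun m n hmn => ?_, fun n => ?_⟩, rfl⟩
  · rw [← hrd m, ← hrd n]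
    exact congrArg (H.dist x) hmn
  · simp only [hr]
    exact hadj _

end Reachability

section Forests

variable {V : Type*} {G : SimpleGraph V}

lemma reachable_belowGraph_iff {α : Type*} [LinearOrder α] {U : Sym2 V → α} {t : α} {a b : V} :
    (belowGraph G U t).Reachable a b ↔ ∃ p : G.Walk a b, ∀ f ∈ p.edges, U f < t := by
  constructor
  · rintro ⟨p⟩
    induction p with
    | nil => exact ⟨.nil, by simp⟩
    | cons h _ ih =>
      obtain ⟨q, hq⟩ := ih
      refine ⟨.cons h.1 q, ?_⟩
      simpa using ⟨h.2, hq⟩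
  · rintro ⟨p, hp⟩
    induction p with
    | nil => exact .rfl
    | cons h _ ih =>
      simp only [Walk.edges_cons, List.forall_mem_cons] at hp
      exact (SimpleGraph.Adj.reachable (G := belowGraph G U t) ⟨h, hp.1⟩).trans (ih hp.2)

lemma not_reachable_belowGraph_iff {α : Type*} [LinearOrder α] {U : Sym2 V → α} {t : α}
    {a b : V} : ¬ (belowGraph G U t).Reachable a b ↔
      ∀ p : G.Walk a b, p.IsPath → ∃ f ∈ p.edges, t ≤ U f := by
  classical
  rw [reachable_belowGraph_iff]
  push Not
  exact ⟨fun h p _ => h p, fun h p =>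
    let ⟨f, hf, hle⟩ := h p.bypass p.bypass_isPath
    ⟨f, p.edges_bypass_subset_edges hf, hle⟩⟩

lemma mstEdges_eq_forestOf {α : Type*} [LinearOrder α] (U : Sym2 V → α) :
    mstEdges G U = forestOf SimpleGraph.Reachable G U := by
  simp only [mstEdges, forestOf, not_reachable_belowGraph_iff]

lemma isRay_belowGraph_iff {α : Type*} [LinearOrder α] {U : Sym2 V → α} {t : α} {r : ℕ → V} :
    IsRay (belowGraph G U t) r ↔ IsRay G r ∧ ∀ f ∈ rayEdges r, U f < t := by
  simp only [IsRay, belowGraph, rayEdges, Set.forall_mem_range, forall_and, and_assoc]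

lemma wmsfEdges_eq_forestOf (hlf : ∀ v : V, (G.neighborSet v).Finite) (U : Sym2 V → ℝ) :
    wmsfEdges G U = forestOf WiredReachable G U := by
  ext e
  refine and_congr_right fun _ => forall_congr' fun a => forall_congr' fun b =>
    imp_congr_right fun _ => ?_
  rw [← not_reachable_belowGraph_iff, WiredReachable, not_or]
  refine and_congr_right fun hab => ?_
  have hlf' : ∀ v, ((belowGraph G U (U e)).neighborSet v).Finite :=
    fun v => (hlf v).subset fun _ h => h.1
  constructor
  · rintro h ⟨ha, hb⟩
    obtain ⟨r₁, hr₁, rfl⟩ := ha.exists_isRay hlf'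
    obtain ⟨r₂, hr₂, rfl⟩ := hb.exists_isRay hlf'
    have h₁ := isRay_belowGraph_iff.1 hr₁
    have h₂ := isRay_belowGraph_iff.1 hr₂
    obtain ⟨f, hf, hle⟩ := h r₁ r₂ h₁.1 h₂.1 rfl rfl fun m n hmn =>
      hab ((hr₁.reachable m).trans (hmn ▸ (hr₂.reachable n).symm))
    exact hle.not_gt (hf.elim (h₁.2 f) (h₂.2 f))
  · rintro h r₁ r₂ hr₁ hr₂ rfl rfl -
    by_contra! hcon
    exact h ⟨(isRay_belowGraph_iff.2 ⟨hr₁, fun f hf => hcon f (Or.inl hf)⟩).infiniteComponent,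
      (isRay_belowGraph_iff.2 ⟨hr₂, fun f hf => hcon f (Or.inr hf)⟩).infiniteComponent⟩

end Forests

section Measurability

lemma infiniteComponent_iff {V : Type*} {H : SimpleGraph V} {x : V} :
    InfiniteComponent H x ↔ ∀ s : Finset V, ∃ y, y ∉ s ∧ H.Reachable x y := by
  refine ⟨fun h s => ?_, fun h hfin => ?_⟩
  · obtain ⟨y, hy, hys⟩ := h.exists_notMem_finset s
    exact ⟨y, hys, hy⟩
  · obtain ⟨y, hy, hr⟩ := h (Set.Finite.toFinset hfin)
    exact hy ((Set.Finite.mem_toFinset hfin).2 hr)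

variable {V : Type*} [Countable V] {G : SimpleGraph V}

lemma measurableSet_reachable_belowGraph (e : Sym2 V) (a b : V) :
    MeasurableSet {U : Sym2 V → ℝ | (belowGraph G U (U e)).Reachable a b} := by
  have : Countable (G.Walk a b) :=
    Function.Injective.countable (f := fun p : G.Walk a b => p.support)
      fun _ _ h => Walk.ext_support h
  simp only [reachable_belowGraph_iff, Set.ofPred_exists, Set.ofPred_forall]
  exact .iUnion fun p => .iInter fun f => .iInter fun _ =>
    measurableSet_lt (measurable_pi_apply f) (measurable_pi_apply e)

lemma measurableSet_infiniteComponent_belowGraph (e : Sym2 V) (a : V) :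
    MeasurableSet {U : Sym2 V → ℝ | InfiniteComponent (belowGraph G U (U e)) a} := by
  have h : {U : Sym2 V → ℝ | InfiniteComponent (belowGraph G U (U e)) a} =
      ⋂ s : Finset V, ⋃ y, ⋃ _ : y ∉ s, {U | (belowGraph G U (U e)).Reachable a y} := by
    ext U
    simp [infiniteComponent_iff]
  rw [h]
  exact .iInter fun s => .iUnion fun y => .iUnion fun _ => measurableSet_reachable_belowGraph e a y

lemma measurableSet_wiredReachable_belowGraph (e : Sym2 V) (a b : V) :
    MeasurableSet {U : Sym2 V → ℝ | WiredReachable (belowGraph G U (U e)) a b} :=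
  (measurableSet_reachable_belowGraph e a b).union
    ((measurableSet_infiniteComponent_belowGraph e a).inter
      (measurableSet_infiniteComponent_belowGraph e b))

lemma measurable_forestOf {R : SimpleGraph V → V → V → Prop}
    (hR : ∀ e a b, MeasurableSet {U : Sym2 V → ℝ | R (belowGraph G U (U e)) a b}) :
    Measurable[_, edgeSigma Set.univ] fun U : Sym2 V → ℝ => forestOf R G U := by
  refine @measurable_generateFrom _ _ _ _ _ ?_
  rintro _ ⟨e, -, rfl⟩
  have h : (fun U : Sym2 V → ℝ => forestOf R G U) ⁻¹' {F | e ∈ F} =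
      {_U : Sym2 V → ℝ | e ∈ G.edgeSet} ∩
        ⋂ a, ⋂ b, ⋂ _ : e = s(a, b), {U : Sym2 V → ℝ | R (belowGraph G U (U e)) a b}ᶜ := by
    ext U
    simp [forestOf]
  rw [h]
  exact (MeasurableSet.const _).inter
    (.iInter fun a => .iInter fun b => .iInter fun _ => (hR e a b).compl)

end Measurability

section ZeroOne

open ProbabilityTheory

lemma mem_iff_mem_of_measurableSet_edgeSigma {V : Type*} {s : Set (Sym2 V)}
    {A : Set (Set (Sym2 V))} (hA : MeasurableSet[edgeSigma s] A) {F F' : Set (Sym2 V)}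
    (h : ∀ e ∈ s, e ∈ F ↔ e ∈ F') : F ∈ A ↔ F' ∈ A := by
  refine MeasurableSpace.generateFrom_induction _
    (fun A _ => F ∈ A ↔ F' ∈ A) ?_ ?_ ?_ ?_ A hA
  · rintro _ ⟨e, he, rfl⟩ -
    exact h e he
  · simp
  · exact fun _ _ ih => not_congr ih
  · intro f _ ih
    simp only [Set.mem_iUnion, ih]

/-- Tail events do not distinguish between edge sets with finite symmetric difference. -/
lemma mem_iff_mem_of_measurableSet_tailSigma {V : Type*} {A : Set (Set (Sym2 V))}
    (hA : MeasurableSet[tailSigma V] A) {F F' : Set (Sym2 V)} (h : (symmDiff F F').Finite) :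
    F ∈ A ↔ F' ∈ A := by
  rw [tailSigma, MeasurableSpace.measurableSet_iInf] at hA
  refine mem_iff_mem_of_measurableSet_edgeSigma (hA h.toFinset) fun e he => ?_
  rw [Set.Finite.coe_toFinset, Set.mem_compl_iff, Set.mem_symmDiff] at he
  tauto

/-- A form of Kolmogorov's zero-one law: an event that, for every finite set `K` of coordinates,
almost surely coincides with an event depending only on the coordinates outside `K` is trivial. -/
lemma measure_eq_zero_or_one_of_ae_eq_cofinite {ι : Type*} {μ : Measure (ι → ℝ)}
    [IsProbabilityMeasure μ] (hind : iIndepFun (fun i (U : ι → ℝ) => U i) μ) {B : Set (ι → ℝ)}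
    (hB : MeasurableSet B)
    (htail : ∀ K : Finset ι, ∃ B', B' =ᵐ[μ] B ∧
      MeasurableSet[⨆ i ∈ (↑K : Set ι)ᶜ,
        MeasurableSpace.comap (fun U : ι → ℝ => U i) inferInstance] B') :
    μ B = 0 ∨ μ B = 1 := by
  classical
  let m : ι → MeasurableSpace (ι → ℝ) :=
    fun i => MeasurableSpace.comap (fun U : ι → ℝ => U i) inferInstance
  have hm : ∀ i, m i ≤ MeasurableSpace.pi := fun i => (measurable_pi_apply i).comap_le
  have hsing : MeasurableSpace.generateFrom {B} ≤ MeasurableSpace.pi :=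
    MeasurableSpace.generateFrom_le (by rintro _ rfl; exact hB)
  have hK : ∀ K : Finset ι,
      Indep (⨆ i ∈ (↑K : Set ι), m i) (MeasurableSpace.generateFrom {B}) μ := by
    intro K
    have hle : ⨆ i ∈ (↑K : Set ι), m i ≤ MeasurableSpace.pi := iSup₂_le fun i _ => hm i
    obtain ⟨B', hBB', hB'⟩ := htail K
    have h := indep_iSup_of_disjoint hm hind (S := (↑K : Set ι)) (T := (↑K : Set ι)ᶜ)
      disjoint_compl_right
    refine IndepSets.indep hle hsing (@MeasurableSpace.isPiSystem_measurableSet _ (_))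
      (IsPiSystem.singleton B) (@MeasurableSpace.generateFrom_measurableSet _ (_)).symm rfl ?_
    rw [IndepSets_iff]
    rintro C _ hC rfl
    rw [← measure_congr hBB', ← measure_congr ((Filter.EventuallyEq.refl _ C).inter hBB')]
    exact (Indep_iff _ _ _).1 h C B' hC hB'
  have hall := indep_iSup_of_directed_le hK (fun K => iSup₂_le fun i _ => hm i) hsing
    (directed_of_isDirected_le fun K L hKL => biSup_mono fun i hi => Finset.mem_of_subset hKL hi)
  have hle : MeasurableSpace.pi ≤ ⨆ K : Finset ι, ⨆ i ∈ (↑K : Set ι), m i :=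
    iSup_le fun i => le_iSup_of_le {i} (le_iSup₂_of_le i (by simp) le_rfl)
  refine measure_eq_zero_or_one_of_indepSet_self (μ := μ) ?_
  refine (indepSet_iff_measure_inter_eq_mul hB hB μ).2 ?_
  exact (Indep_iff _ _ _).1 hall B B (hle _ hB)
    (MeasurableSpace.measurableSet_generateFrom rfl)

variable {V : Type*} {μ : Measure (Sym2 V → ℝ)}

lemma measure_label_mem
    (hiid : ∀ (s : Finset (Sym2 V)) (t : Sym2 V → Set ℝ), (∀ e, MeasurableSet (t e)) →
      μ {U : Sym2 V → ℝ | ∀ e ∈ s, U e ∈ t e} = ∏ e ∈ s, volume (t e ∩ Set.Icc 0 1))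
    (e : Sym2 V) {t : Set ℝ} (ht : MeasurableSet t) :
    μ {U : Sym2 V → ℝ | U e ∈ t} = volume (t ∩ Set.Icc 0 1) := by
  simpa using hiid {e} (fun _ => t) fun _ => ht

lemma iIndepFun_labels
    (hiid : ∀ (s : Finset (Sym2 V)) (t : Sym2 V → Set ℝ), (∀ e, MeasurableSet (t e)) →
      μ {U : Sym2 V → ℝ | ∀ e ∈ s, U e ∈ t e} = ∏ e ∈ s, volume (t e ∩ Set.Icc 0 1)) :
    iIndepFun (fun e (U : Sym2 V → ℝ) => U e) μ := by
  classical
  rw [iIndepFun_iff_measure_inter_preimage_eq_mul]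
  intro s t ht
  have h := hiid s (fun e => if e ∈ s then t e else Set.univ) fun e => by
    by_cases he : e ∈ s
    · simpa [he] using ht e he
    · simp [he]
  convert h using 1
  · congr 1
    ext U
    simp +contextual
  · refine Finset.prod_congr rfl fun e he => ?_
    rw [if_pos he]
    exact measure_label_mem hiid e (ht e he)

variable [Countable V]

lemma ae_labels_ne
    (hiid : ∀ (s : Finset (Sym2 V)) (t : Sym2 V → Set ℝ), (∀ e, MeasurableSet (t e)) →
      μ {U : Sym2 V → ℝ | ∀ e ∈ s, U e ∈ t e} = ∏ e ∈ s, volume (t e ∩ Set.Icc 0 1))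
    (c : Sym2 V → ℝ) : ∀ᵐ U ∂μ, ∀ e f, U e ≠ c f := by
  rw [ae_all_iff]
  intro e
  rw [ae_all_iff]
  intro f
  have h := measure_label_mem hiid e (measurableSet_singleton (c f))
  rw [measure_mono_null Set.inter_subset_left (by simp)] at h
  simpa [ae_iff] using h

variable [IsProbabilityMeasure μ]

lemma ae_injective_labels
    (hiid : ∀ (s : Finset (Sym2 V)) (t : Sym2 V → Set ℝ), (∀ e, MeasurableSet (t e)) →
      μ {U : Sym2 V → ℝ | ∀ e ∈ s, U e ∈ t e} = ∏ e ∈ s, volume (t e ∩ Set.Icc 0 1)) :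
    ∀ᵐ U ∂μ, Function.Injective U := by
  have h : ∀ e f : Sym2 V, e ≠ f → ∀ᵐ U ∂μ, U e ≠ U f := by
    intro e f hef
    have hmap : ∀ e, μ.map (fun U : Sym2 V → ℝ => U e) = volume.restrict (Set.Icc 0 1) := by
      intro e
      ext t ht
      rw [Measure.map_apply (measurable_pi_apply e) ht, Measure.restrict_apply ht]
      exact measure_label_mem hiid e ht
    have hprod := ((iIndepFun_labels hiid).indepFun hef).map_prod_eq_prod_map_map
      (measurable_pi_apply e).aemeasurable (measurable_pi_apply f).aemeasurable
    rw [hmap, hmap] at hprod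
    have hdiag : ∀ᵐ z ∂μ.map (fun U : Sym2 V → ℝ => (U e, U f)), z.1 ≠ z.2 := by
      rw [hprod]
      refine (Measure.ae_prod_iff_ae_ae
        (measurableSet_eq_fun measurable_fst measurable_snd).compl).2 ?_
      exact Filter.Eventually.of_forall fun x => by
        rw [ae_iff]
        simp
    exact ae_of_ae_map (f := fun U : Sym2 V → ℝ => (U e, U f)) (by fun_prop) hdiag
  have h' : ∀ᵐ U ∂μ, ∀ e f : Sym2 V, e ≠ f → U e ≠ U f := by
    simpa only [ae_all_iff] using h
  filter_upwards [h'] with U hU e f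
  exact not_imp_not.1 (hU e f)

lemma measure_forestOf_mem_eq_zero_or_one
    (hiid : ∀ (s : Finset (Sym2 V)) (t : Sym2 V → Set ℝ), (∀ e, MeasurableSet (t e)) →
      μ {U : Sym2 V → ℝ | ∀ e ∈ s, U e ∈ t e} = ∏ e ∈ s, volume (t e ∩ Set.Icc 0 1))
    {G : SimpleGraph V} {R : SimpleGraph V → V → V → Prop} (hR : IsConnectivity R)
    (hRm : ∀ e a b, MeasurableSet {U : Sym2 V → ℝ | R (belowGraph G U (U e)) a b})
    {A : Set (Set (Sym2 V))} (hA : MeasurableSet[tailSigma V] A) :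
    μ {U : Sym2 V → ℝ | forestOf R G U ∈ A} = 0 ∨
      μ {U : Sym2 V → ℝ | forestOf R G U ∈ A} = 1 := by
  classical
  have hA' : MeasurableSet[edgeSigma Set.univ] A := by
    have := MeasurableSpace.measurableSet_iInf.1 hA ∅
    rwa [Finset.coe_empty, Set.compl_empty] at this
  have hB : MeasurableSet {U : Sym2 V → ℝ | forestOf R G U ∈ A} := measurable_forestOf hRm hA'
  obtain ⟨n, hn⟩ := exists_injective_nat (Sym2 V)
  let c : Sym2 V → ℝ := fun e => n e
  have hc : Function.Injective c := Nat.cast_injective.comp hn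
  refine measure_eq_zero_or_one_of_ae_eq_cofinite (iIndepFun_labels hiid) hB fun K =>
    ⟨(fun U => K.piecewise c U) ⁻¹' {U | forestOf R G U ∈ A}, ?_, ?_⟩
  · filter_upwards [ae_injective_labels hiid, ae_labels_ne hiid c] with U hU hUc
    exact propext (mem_iff_mem_of_measurableSet_tailSigma hA
      (finite_symmDiff_piecewise hR hU hc hUc K)).symm
  · refine (@measurable_pi_iff _ _ _ (_) _ _).2 (fun e => ?_) hB
    by_cases he : e ∈ K
    · simp only [Finset.piecewise_eq_of_mem _ _ _ he]
      exact @measurable_const _ _ _ (_) _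
    · simp only [Finset.piecewise_eq_of_notMem _ _ _ he]
      exact Measurable.of_comap_le (le_iSup₂_of_le e (by simpa using he) le_rfl)

end ZeroOne

/-- Let `G` be an infinite, locally finite, connected graph with
countably many edges, and let `μ` make the coordinates `U(e)` i.i.d. uniform on
`[0,1]` (expressed through its finite-dimensional marginals). Then for every tail
event `A`, the probability that the free (resp. wired) minimal spanning forest
lies in `A` is `0` or `1`. -/
theorem stmt12 {V : Type*} [Infinite V] [Countable V] (G : SimpleGraph V)
    (hlf : ∀ v : V, (G.neighborSet v).Finite) (hG : G.Connected)
    (μ : Measure (Sym2 V → ℝ)) [IsProbabilityMeasure μ]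
    (hiid : ∀ (s : Finset (Sym2 V)) (t : Sym2 V → Set ℝ), (∀ e, MeasurableSet (t e)) →
      μ {U : Sym2 V → ℝ | ∀ e ∈ s, U e ∈ t e} = ∏ e ∈ s, volume (t e ∩ Set.Icc 0 1))
    (A : Set (Set (Sym2 V))) (hA : MeasurableSet[tailSigma V] A) :
    (μ {U : Sym2 V → ℝ | mstEdges G U ∈ A} = 0 ∨
      μ {U : Sym2 V → ℝ | mstEdges G U ∈ A} = 1) ∧
    (μ {U : Sym2 V → ℝ | wmsfEdges G U ∈ A} = 0 ∨
      μ {U : Sym2 V → ℝ | wmsfEdges G U ∈ A} = 1) := by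
  constructor
  · simp only [mstEdges_eq_forestOf]
    exact measure_forestOf_mem_eq_zero_or_one hiid isConnectivity_reachable
      measurableSet_reachable_belowGraph hA
  · simp only [wmsfEdges_eq_forestOf hlf]
    exact measure_forestOf_mem_eq_zero_or_one hiid isConnectivity_wiredReachable
      measurableSet_wiredReachable_belowGraph hA
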